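/- arXiv:1910.12697 — 2 statements merged into one kernel-verified Lean document; each statement's English description precedes it below -/
import Mathlib

section
/- Under the same setting and structural assumptions (i)–(iv) on the hypothesis sets Θ_1, …, Θ_M as above, suppose additionally that for each θ ∈ ⋃_m Θ_m the maximizer q*(θ) = argmax_{q ∈ P} inf_{θ' ∈ ⋃_m Θ_m \ Θ_{g(θ)}} Σ_{u=1}^K q_u D_u(θ‖θ') is unique. Then the map θ ↦ q*(θ) is continuous on ⋃_m Θ_m. -/
open Finset Filter

/-- The standard probability simplex in `ℝ^K`. -/
def simplex (K : ℕ) : Set (Fin K → ℝ) := {q | (∀ u, 0 ≤ q u) ∧ ∑ u, q u = 1}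

/-- Kullback–Leibler divergence (Bregman form) between the members of the `u`-th
single-parameter exponential family with natural parameters `θ u` and `θ' u`:
`D_u(θ‖θ') = A_u(θ'_u) − A_u(θ_u) − A_u'(θ_u)(θ'_u − θ_u)`. -/
noncomputable def KLdiv (K : ℕ) (A : Fin K → ℝ → ℝ) (θ θ' : Fin K → ℝ) (u : Fin K) : ℝ :=
  A u (θ' u) - A u (θ u) - deriv (A u) (θ u) * (θ' u - θ u)

/-- `f₀(q, θ) = inf_{θ' ∈ ⋃ₘ Θₘ \ Θ_{g(θ)}} ∑ u, q u * D_u(θ‖θ')`. -/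
noncomputable def f0 (K M : ℕ) (A : Fin K → ℝ → ℝ) (Θ : Fin M → Set (Fin K → ℝ))
    (g : (Fin K → ℝ) → Fin M) (q θ : Fin K → ℝ) : ℝ :=
  ⨅ θ' : ((⋃ m, Θ m) \ Θ (g θ) : Set (Fin K → ℝ)), ∑ u, q u * KLdiv K A θ θ' u

open Topology

/-- The Bregman divergence of a function `a : ℝ → ℝ`. -/
noncomputable def bregman (a : ℝ → ℝ) (t s : ℝ) : ℝ :=
  a s - a t - deriv a t * (s - t)

section Bregman

variable {a : ℝ → ℝ}

lemma ConvexOn.bregman_nonneg (ha : ConvexOn ℝ Set.univ a) (hd : Differentiable ℝ a) (t s : ℝ) :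
    0 ≤ bregman a t s := by
  unfold bregman
  rcases lt_trichotomy t s with h | rfl | h
  · have h1 := ha.deriv_le_slope (Set.mem_univ t) (Set.mem_univ s) h (hd t)
    rw [slope_def_field, le_div_iff₀ (sub_pos.2 h)] at h1
    linarith
  · simp
  · have h1 := ha.slope_le_deriv (Set.mem_univ s) (Set.mem_univ t) h (hd t)
    rw [slope_def_field, div_le_iff₀ (sub_pos.2 h)] at h1
    linarith

lemma ConvexOn.continuous_deriv_of_differentiable (ha : ConvexOn ℝ Set.univ a)
    (hd : Differentiable ℝ a) : Continuous (deriv a) := by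
  have hc := hd.continuous
  refine continuous_iff_continuousAt.2 fun t₀ => tendsto_order.2 ⟨fun c h => ?_, fun c h => ?_⟩
  · have hs := (hasDerivAt_iff_tendsto_slope.1 (hd t₀).hasDerivAt).mono_left
      (nhdsLT_le_nhdsNE t₀)
    obtain ⟨s, hs, hst⟩ := ((hs.eventually_const_lt h).and self_mem_nhdsWithin).exists
    have hst : s < t₀ := hst
    have hcont : ContinuousAt (fun t => (a t - a s) / (t - s)) t₀ :=
      (by fun_prop : ContinuousAt (fun t => a t - a s) t₀).div (by fun_prop)
        (sub_pos.2 hst).ne'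
    rw [slope_comm, slope_def_field] at hs
    filter_upwards [hcont.eventually_const_lt hs, lt_mem_nhds hst] with t ht hst'
    refine ht.trans_le ?_
    rw [← slope_def_field]
    exact ha.slope_le_deriv (Set.mem_univ s) (Set.mem_univ t) hst' (hd t)
  · have hs := (hasDerivAt_iff_tendsto_slope.1 (hd t₀).hasDerivAt).mono_left
      (nhdsGT_le_nhdsNE t₀)
    obtain ⟨s, hs, hst⟩ := ((hs.eventually_lt_const h).and self_mem_nhdsWithin).exists
    have hst : t₀ < s := hst
    have hcont : ContinuousAt (fun t => (a s - a t) / (s - t)) t₀ :=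
      (by fun_prop : ContinuousAt (fun t => a s - a t) t₀).div (by fun_prop)
        (sub_pos.2 hst).ne'
    rw [slope_def_field] at hs
    filter_upwards [hcont.eventually_lt_const hs, gt_mem_nhds hst] with t ht hst'
    refine lt_of_le_of_lt ?_ ht
    rw [← slope_def_field]
    exact ha.deriv_le_slope (Set.mem_univ t) (Set.mem_univ s) hst' (hd t)

/-- On a ray, a nonnegative convex function vanishing at the endpoint either vanishes identically
or grows at least linearly. -/
lemma ConvexOn.eq_zero_or_le_mul_one_add {φ : ℝ → ℝ} (hφ : ConvexOn ℝ Set.univ φ)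
    (h0 : φ 0 = 0) (hnn : ∀ r, 0 ≤ φ r) :
    ∃ C, 0 ≤ C ∧ ∀ r, 0 ≤ r → φ r = 0 ∨ r ≤ C * (1 + φ r) := by
  by_cases hz : ∀ r, 0 ≤ r → φ r = 0
  · exact ⟨0, le_rfl, fun r hr => Or.inl (hz r hr)⟩
  push Not at hz
  obtain ⟨r₁, hr₁, hne⟩ := hz
  have hr₁ : 0 < r₁ := hr₁.lt_of_ne fun h => hne (h ▸ h0)
  have hd : 0 < φ r₁ := (hnn r₁).lt_of_ne' hne
  refine ⟨r₁ + r₁ / φ r₁, by positivity, fun r hr => Or.inr ?_⟩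
  have hexp : (r₁ + r₁ / φ r₁) * (1 + φ r)
      = r₁ + r₁ / φ r₁ * φ r + (r₁ / φ r₁ + r₁ * φ r) := by ring
  have hrest : 0 ≤ r₁ / φ r₁ + r₁ * φ r := by have := hnn r; positivity
  have hmid : 0 ≤ r₁ / φ r₁ * φ r := by have := hnn r; positivity
  rcases le_total r r₁ with h | h
  · linarith
  · have hr' : 0 < r := hr₁.trans_le h
    have hconv := hφ.2 (Set.mem_univ 0) (Set.mem_univ r)
      (sub_nonneg.2 ((div_le_one hr').2 h)) (div_nonneg hr₁.le hr) (sub_add_cancel 1 (r₁ / r))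
    simp only [smul_eq_mul, mul_zero, zero_add, h0, div_mul_cancel₀ _ hr'.ne'] at hconv
    have : r ≤ r₁ / φ r₁ * φ r := by
      rw [div_mul_eq_mul_div, le_div_iff₀ hd]
      rw [div_mul_eq_mul_div, le_div_iff₀ hr'] at hconv
      linarith
    linarith

lemma ConvexOn.bregman_eq_zero_or_abs_sub_le (ha : ConvexOn ℝ Set.univ a)
    (hd : Differentiable ℝ a) (t : ℝ) :
    ∃ C, 0 ≤ C ∧ ∀ s, bregman a t s = 0 ∨ |s - t| ≤ C * (1 + bregman a t s) := by
  have hconv : ∀ c : ℝ, ConvexOn ℝ Set.univ (fun r => bregman a t (t + c * r)) := by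
    refine fun c => ⟨convex_univ, fun x _ y _ p q hp hq hpq => ?_⟩
    have h := ha.2 (Set.mem_univ (t + c * x)) (Set.mem_univ (t + c * y)) hp hq hpq
    simp only [smul_eq_mul, bregman] at h ⊢
    have e : p * (t + c * x) + q * (t + c * y) = t + c * (p * x + q * y) := by
      linear_combination t * hpq
    rw [e] at h
    linear_combination h + (a t) * hpq
  obtain ⟨C₁, hC₁, h₁⟩ := (hconv 1).eq_zero_or_le_mul_one_add (by simp [bregman])
    fun r => ha.bregman_nonneg hd _ _
  obtain ⟨C₂, hC₂, h₂⟩ := (hconv (-1)).eq_zero_or_le_mul_one_add (by simp [bregman])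
    fun r => ha.bregman_nonneg hd _ _
  refine ⟨C₁ + C₂, by positivity, fun s => ?_⟩
  have hnn := ha.bregman_nonneg hd t s
  rcases le_total t s with h | h
  · refine (h₁ (s - t) (sub_nonneg.2 h)).imp (fun h => ?_) fun h' => ?_
    · simpa using h
    · rw [abs_of_nonneg (sub_nonneg.2 h)]
      simp only [one_mul, add_sub_cancel] at h'
      nlinarith
  · refine (h₂ (t - s) (sub_nonneg.2 h)).imp (fun h => ?_) fun h' => ?_
    · simpa using h
    · rw [abs_of_nonpos (sub_nonpos.2 h)]
      simp only [neg_mul, one_mul, neg_sub, add_sub_cancel] at h'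
      nlinarith

/-- Lower semicontinuity of the Bregman divergence in its first argument, with an error that is
uniform in the (unbounded) second argument. -/
lemma ConvexOn.eventually_bregman_ge (ha : ConvexOn ℝ Set.univ a) (hd : Differentiable ℝ a)
    (t₀ : ℝ) {ε : ℝ} (hε : 0 < ε) :
    ∀ᶠ t in 𝓝 t₀, ∀ s, (1 - ε) * bregman a t₀ s - ε ≤ bregman a t s := by
  obtain ⟨C, hC, h⟩ := ha.bregman_eq_zero_or_abs_sub_le hd t₀
  have hc := hd.continuous
  have hc' := ha.continuous_deriv_of_differentiable hd
  have hlim₂ : ContinuousAt (fun t => |deriv a t₀ - deriv a t| * C) t₀ := by fun_prop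
  filter_upwards [hlim₂.eventually_lt_const (u := ε / 2) (by simpa using by positivity)] with t ht s
  have hnn := ha.bregman_nonneg hd t s
  have hnn₀ := ha.bregman_nonneg hd t₀ s
  have hnn₁ := ha.bregman_nonneg hd t t₀
  rcases h s with hs | hs
  · rw [hs]; linarith
  · have key : bregman a t s
        = bregman a t₀ s + bregman a t t₀ + (deriv a t₀ - deriv a t) * (s - t₀) := by
      unfold bregman; ring
    have hb : |(deriv a t₀ - deriv a t) * (s - t₀)| ≤ ε / 2 * (1 + bregman a t₀ s) := by
      rw [abs_mul]
      calc _ ≤ |deriv a t₀ - deriv a t| * (C * (1 + bregman a t₀ s)) := by gcongr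
        _ = |deriv a t₀ - deriv a t| * C * (1 + bregman a t₀ s) := by ring
        _ ≤ _ := by gcongr
    have := (abs_le.1 hb).1
    nlinarith

end Bregman

/-- If, for every competitor `q`, the parametrized objective at `q₀` is larger near `(x₀, q)`,
then every selection of maximizers over a compact set is continuous at `x₀`. -/
lemma IsCompact.tendsto_of_eventually_lt {X Y : Type*} [TopologicalSpace X] [TopologicalSpace Y]
    {S : Set Y} (hS : IsCompact S) {T : Set X} {x₀ : X} {q₀ : Y} (f : Y → X → ℝ) (q : X → Y)
    (hq : ∀ᶠ x in 𝓝[T] x₀, q x ∈ S ∧ f q₀ x ≤ f (q x) x)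
    (h : ∀ y ∈ S, y ≠ q₀ → ∀ᶠ z : X × Y in 𝓝 (x₀, y), z.1 ∈ T → z.2 ∈ S → f z.2 z.1 < f q₀ z.1) :
    Tendsto q (𝓝[T] x₀) (𝓝 q₀) := by
  refine tendsto_nhds.2 fun U hU hqU => ?_
  have hev := (hS.diff hU).eventually_forall_of_forall_eventually
    (x₀ := x₀) (P := fun x y => x ∈ T → y ∈ S → f y x < f q₀ x)
    fun y hy => h y hy.1 fun hyq => hy.2 (hyq ▸ hqU)
  filter_upwards [hq, mem_nhdsWithin_of_mem_nhds hev, self_mem_nhdsWithin] with x hx hx' hxT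
  by_contra hn
  exact (hx' (q x) ⟨hx.1, hn⟩ hxT hx.1).not_ge hx.2

section Objective

variable {K : ℕ} {A : Fin K → ℝ → ℝ}

lemma sum_mul_KLdiv_nonneg (hAconv : ∀ u, ConvexOn ℝ Set.univ (A u))
    (hAdiff : ∀ u, Differentiable ℝ (A u)) {q : Fin K → ℝ} (hq : q ∈ simplex K)
    (θ θ' : Fin K → ℝ) : 0 ≤ ∑ u, q u * KLdiv K A θ θ' u :=
  sum_nonneg fun u _ => mul_nonneg (hq.1 u) ((hAconv u).bregman_nonneg (hAdiff u) _ _)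

lemma continuous_sum_mul_KLdiv (hAconv : ∀ u, ConvexOn ℝ Set.univ (A u))
    (hAdiff : ∀ u, Differentiable ℝ (A u)) (θ' : Fin K → ℝ) :
    Continuous fun z : (Fin K → ℝ) × (Fin K → ℝ) => ∑ u, z.2 u * KLdiv K A z.1 θ' u := by
  have hc := fun u => (hAdiff u).continuous
  have hc' := fun u => (hAconv u).continuous_deriv_of_differentiable (hAdiff u)
  unfold KLdiv
  fun_prop

lemma eventually_sum_mul_KLdiv_ge (hAconv : ∀ u, ConvexOn ℝ Set.univ (A u))
    (hAdiff : ∀ u, Differentiable ℝ (A u)) (θ₀ : Fin K → ℝ) {ε : ℝ} (hε : 0 < ε) :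
    ∀ᶠ θ in 𝓝 θ₀, ∀ q ∈ simplex K, ∀ θ',
      (1 - ε) * ∑ u, q u * KLdiv K A θ₀ θ' u - ε ≤ ∑ u, q u * KLdiv K A θ θ' u := by
  have hev : ∀ᶠ θ in 𝓝 θ₀, ∀ u, ∀ s,
      (1 - ε) * bregman (A u) (θ₀ u) s - ε ≤ bregman (A u) (θ u) s :=
    eventually_all.2 fun u => (continuous_apply u).continuousAt.eventually
      ((hAconv u).eventually_bregman_ge (hAdiff u) (θ₀ u) hε)
  filter_upwards [hev] with θ hθ q hq θ'
  calc (1 - ε) * ∑ u, q u * KLdiv K A θ₀ θ' u - ε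
      = ∑ u, q u * ((1 - ε) * KLdiv K A θ₀ θ' u - ε) := by
        simp only [mul_sub, sum_sub_distrib, ← sum_mul, hq.2, mul_sum, one_mul]
        congr 1
        exact sum_congr rfl fun u _ => by ring
    _ ≤ _ := sum_le_sum fun u _ => mul_le_mul_of_nonneg_left (hθ u (θ' u)) (hq.1 u)

variable {M : ℕ} {Θ : Fin M → Set (Fin K → ℝ)} {g : (Fin K → ℝ) → Fin M}

lemma f0_le (hAconv : ∀ u, ConvexOn ℝ Set.univ (A u))
    (hAdiff : ∀ u, Differentiable ℝ (A u)) {q : Fin K → ℝ} (hq : q ∈ simplex K)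
    (θ : Fin K → ℝ) {θ' : Fin K → ℝ} (hθ' : θ' ∈ (⋃ m, Θ m) \ Θ (g θ)) :
    f0 K M A Θ g q θ ≤ ∑ u, q u * KLdiv K A θ θ' u :=
  ciInf_le (f := fun θ' : ((⋃ m, Θ m) \ Θ (g θ) : Set (Fin K → ℝ)) =>
      ∑ u, q u * KLdiv K A θ θ' u)
    ⟨0, by rintro _ ⟨θ', rfl⟩; exact sum_mul_KLdiv_nonneg hAconv hAdiff hq _ _⟩ ⟨θ', hθ'⟩

/-- The objective at `q₀` strictly exceeds the objective at any `q'` near a strictly worse `q`,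
for all `θ` near `θ₀` having the same alternative set as `θ₀`. -/
lemma eventually_f0_lt (hAconv : ∀ u, ConvexOn ℝ Set.univ (A u))
    (hAdiff : ∀ u, Differentiable ℝ (A u)) {θ₀ : Fin K → ℝ}
    (halt : ((⋃ m, Θ m) \ Θ (g θ₀)).Nonempty) {q₀ q : Fin K → ℝ}
    (hq₀ : q₀ ∈ simplex K) (hq : q ∈ simplex K)
    (hlt : f0 K M A Θ g q θ₀ < f0 K M A Θ g q₀ θ₀) :
    ∀ᶠ z : (Fin K → ℝ) × (Fin K → ℝ) in 𝓝 (θ₀, q),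
      z.2 ∈ simplex K → g z.1 = g θ₀ → f0 K M A Θ g z.2 z.1 < f0 K M A Θ g q₀ z.1 := by
  have : Nonempty ((⋃ m, Θ m) \ Θ (g θ₀) : Set (Fin K → ℝ)) := halt.to_subtype
  obtain ⟨⟨θ', hθ'⟩, hval⟩ := exists_lt_of_ciInf_lt hlt
  obtain ⟨c, hc, hc'⟩ := exists_between hval
  have hc₀ : 0 < c := (sum_mul_KLdiv_nonneg hAconv hAdiff hq θ₀ θ').trans_lt hc
  set F := f0 K M A Θ g q₀ θ₀
  have hF₁ : 0 < F + 1 := by linarith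
  obtain ⟨ε, hε, hεF⟩ : ∃ ε, 0 < ε ∧ ε * (F + 1) = F - c :=
    ⟨(F - c) / (F + 1), div_pos (sub_pos.2 hc') hF₁, div_mul_cancel₀ _ hF₁.ne'⟩
  have hε₁ : ε ≤ 1 := by nlinarith
  have hup := ((continuous_sum_mul_KLdiv hAconv hAdiff θ').tendsto (θ₀, q)).eventually_lt_const hc
  have hlow := (continuous_fst.tendsto (θ₀, q)).eventually
    (eventually_sum_mul_KLdiv_ge hAconv hAdiff θ₀ hε)
  filter_upwards [hup, hlow] with z hz hz' hzS hgz
  refine (f0_le hAconv hAdiff hzS z.1 (by rwa [hgz])).trans_lt (hz.trans_le ?_)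
  have : Nonempty ((⋃ m, Θ m) \ Θ (g z.1) : Set (Fin K → ℝ)) := by rwa [hgz]
  refine le_ciInf fun ⟨η, hη⟩ => ?_
  have hη₀ : F ≤ ∑ u, q₀ u * KLdiv K A θ₀ η u := f0_le hAconv hAdiff hq₀ θ₀ (by rwa [← hgz])
  have := hz' q₀ hq₀ η
  have := mul_le_mul_of_nonneg_left hη₀ (sub_nonneg.2 hε₁)
  linarith

end Objective

/-- If distinct members of a finite family are at positive distance from a point `θ₀` of the
member indexed by `k₀`, then points of the union near `θ₀` belong to that member. -/
lemma eventually_mem_of_infDist_pos {ι X : Type*} [Finite ι] [PseudoMetricSpace X]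
    {Γ : ι → Set X} {k₀ : ι} {θ₀ : X} (h : ∀ k, k₀ ≠ k → 0 < Metric.infDist θ₀ (Γ k)) :
    ∀ᶠ θ in 𝓝 θ₀, ∀ k, θ ∈ Γ k → k = k₀ := by
  refine eventually_all.2 fun k => ?_
  by_cases hk : k₀ = k
  · exact Eventually.of_forall fun _ _ => hk.symm
  filter_upwards [Metric.ball_mem_nhds θ₀ (h k hk)] with θ hθ hmem
  rw [Metric.mem_ball, dist_comm] at hθ
  exact absurd (Metric.infDist_le_dist_of_mem hmem) hθ.not_ge

/-- Under the structural assumptions (i)–(iv) on the composite hypothesis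
sets `Θ₁, …, Θ_M ⊆ ℝ^K`, if for every `θ ∈ ⋃ₘ Θₘ` the maximizer
`q*(θ) = argmax_{q ∈ P} inf_{θ' ∈ ⋃ₘ Θₘ \ Θ_{g(θ)}} ∑ u, q u * D_u(θ‖θ')` over the
probability simplex `P` is unique, then `θ ↦ q*(θ)` is continuous on `⋃ₘ Θₘ`. -/
theorem qstar_continuous
    (K M : ℕ) (hK : 1 ≤ K) (hM : 2 ≤ M)
    (A : Fin K → ℝ → ℝ) (hAconv : ∀ u, ConvexOn ℝ Set.univ (A u))
    (hAdiff : ∀ u, Differentiable ℝ (A u))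
    (Θ : Fin M → Set (Fin K → ℝ)) (hΘne : ∀ m, (Θ m).Nonempty)
    (x : Fin M → ℕ) (Γ : (m : Fin M) → Fin (x m) → Set (Fin K → ℝ))
    -- (i) each `Θ m` is a finite union of the pieces `Γ m i`
    (hdecomp : ∀ m, Θ m = ⋃ i, Γ m i)
    -- (ii) each piece is nonempty, convex, and open in its own affine hull
    (hΓne : ∀ m i, (Γ m i).Nonempty)
    (hΓconv : ∀ m i, Convex ℝ (Γ m i))
    (hΓopen : ∀ m i, IsOpen ((↑) ⁻¹' (Γ m i) : Set (affineSpan ℝ (Γ m i))))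
    -- (iii) all the pieces, over all pairs `(m, i)`, are pairwise disjoint
    (hdisj : ∀ m i m' j, (⟨m, i⟩ : Σ m : Fin M, Fin (x m)) ≠ ⟨m', j⟩ →
      Γ m i ∩ Γ m' j = ∅)
    -- (iv) positive distance from any point of one piece to every other piece
    (hdist : ∀ m i, ∀ θ ∈ Γ m i, ∀ m' j, (⟨m, i⟩ : Σ m : Fin M, Fin (x m)) ≠ ⟨m', j⟩ →
      0 < Metric.infDist θ (Γ m' j))
    -- `g θ` is the (unique) index of the hypothesis set containing `θ`
    (g : (Fin K → ℝ) → Fin M) (hg : ∀ m, ∀ θ ∈ Θ m, g θ = m)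
    -- the alternative set is nonempty
    (halt : ∀ θ ∈ ⋃ m, Θ m, ((⋃ m, Θ m) \ Θ (g θ)).Nonempty)
    -- `qstar θ` is a maximizer of `q ↦ f₀(q, θ)` over the simplex …
    (qstar : (Fin K → ℝ) → (Fin K → ℝ))
    (hmax : ∀ θ ∈ ⋃ m, Θ m, qstar θ ∈ simplex K ∧
      ∀ q ∈ simplex K, f0 K M A Θ g q θ ≤ f0 K M A Θ g (qstar θ) θ)
    -- … and it is the unique such maximizer
    (huniq : ∀ θ ∈ ⋃ m, Θ m, ∀ q ∈ simplex K,
      (∀ q' ∈ simplex K, f0 K M A Θ g q' θ ≤ f0 K M A Θ g q θ) → q = qstar θ) :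
    ContinuousOn qstar (⋃ m, Θ m) := by
  intro θ₀ hθ₀
  obtain ⟨m, hm⟩ := Set.mem_iUnion.1 hθ₀
  obtain ⟨i, hi⟩ := Set.mem_iUnion.1 ((hdecomp m).subset hm)
  have hgloc : ∀ᶠ θ in 𝓝 θ₀, θ ∈ ⋃ m, Θ m → g θ = g θ₀ := by
    have hev : ∀ᶠ θ in 𝓝 θ₀, ∀ k : Σ m : Fin M, Fin (x m), θ ∈ Γ k.1 k.2 → k = ⟨m, i⟩ :=
      eventually_mem_of_infDist_pos fun k hk => hdist m i θ₀ hi k.1 k.2 hk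
    filter_upwards [hev] with θ hθ hmem
    obtain ⟨m', hm'⟩ := Set.mem_iUnion.1 hmem
    obtain ⟨j, hj⟩ := Set.mem_iUnion.1 ((hdecomp m').subset hm')
    rw [hg m' θ hm', hg m θ₀ hm]
    exact congrArg Sigma.fst (hθ ⟨m', j⟩ hj)
  obtain ⟨hq₀, hle⟩ := hmax θ₀ hθ₀
  have hcompact : IsCompact (simplex K) := isCompact_stdSimplex ℝ (Fin K)
  refine hcompact.tendsto_of_eventually_lt (f0 K M A Θ g) qstar ?_ fun q hq hne => ?_
  · filter_upwards [self_mem_nhdsWithin] with θ hθ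
    exact ⟨(hmax θ hθ).1, (hmax θ hθ).2 _ hq₀⟩
  · have hlt : f0 K M A Θ g q θ₀ < f0 K M A Θ g (qstar θ₀) θ₀ :=
      lt_of_not_ge fun h => hne (huniq θ₀ hθ₀ q hq fun q' hq' => (hle q' hq').trans h)
    filter_upwards [eventually_f0_lt hAconv hAdiff (halt θ₀ hθ₀) hq₀ hq hlt,
      (continuous_fst.tendsto (θ₀, q)).eventually hgloc] with z hz hgz hzT hzS
    exact hz hzS (hgz hzT)
end

section
/- Let K ≥ 1 be an integer, C ∈ ℝ, and define v(t) = C + log(t(1+log t)^{K+2}) + √(4K·log(t(1+log t)^{K+2})) for t > 1 and w(α) = |log α| + √(4K·|log α|) for α ∈ (0,1). Let C* > 0 and for α ∈ (0,1) define N₀(α) = inf{ N ∈ ℕ, N ≥ 2 : √N + (v(N) + w(α))/C* ≤ N }. Then N₀(α) is finite for every α ∈ (0,1), and limsup_{α → 0⁺} N₀(α)/|log α| ≤ 1/C*. -/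
open Filter

/-- `v(t) = C + log(t(1+log t)^{K+2}) + √(4K log(t(1+log t)^{K+2}))`. -/
noncomputable def vfun (K : ℕ) (C : ℝ) (t : ℝ) : ℝ :=
  C + Real.log (t * (1 + Real.log t) ^ (K + 2))
    + Real.sqrt (4 * K * Real.log (t * (1 + Real.log t) ^ (K + 2)))

/-- `w(α) = |log α| + √(4K |log α|)`. -/
noncomputable def wfun (K : ℕ) (α : ℝ) : ℝ :=
  |Real.log α| + Real.sqrt (4 * K * |Real.log α|)

/-- `N₀(α) = inf {N ≥ 2 : √N + (v(N) + w(α))/C* ≤ N}`. -/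
noncomputable def N0 (K : ℕ) (C Cstar : ℝ) (α : ℝ) : ℕ :=
  sInf {N : ℕ | 2 ≤ N ∧ Real.sqrt N + (vfun K C N + wfun K α) / Cstar ≤ N}

open scoped Topology

lemma tendsto_sqrt_const_mul_div {f : ℝ → ℝ} (hf : Tendsto (fun t => f t / t) atTop (𝓝 0))
    (a : ℝ) : Tendsto (fun t => Real.sqrt (a * f t) / t) atTop (𝓝 0) := by
  have h : Tendsto (fun t => Real.sqrt (a * (f t / t) * t⁻¹)) atTop (𝓝 0) := by
    simpa using ((hf.const_mul a).mul tendsto_inv_atTop_zero).sqrt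
  refine h.congr' ?_
  filter_upwards [eventually_gt_atTop 0] with t ht
  rw [show a * (f t / t) * t⁻¹ = a * f t / t ^ 2 by field_simp,
    Real.sqrt_div' _ (sq_nonneg t), Real.sqrt_sq ht.le]

lemma tendsto_sqrt_div_self : Tendsto (fun t : ℝ => Real.sqrt t / t) atTop (𝓝 0) := by
  simpa only [Real.sqrt_div_self'] using
    (tendsto_const_nhds (x := (1 : ℝ))).div_atTop Real.tendsto_sqrt_atTop

lemma tendsto_log_mul_one_add_log_pow_div (n : ℕ) :
    Tendsto (fun t : ℝ => Real.log (t * (1 + Real.log t) ^ n) / t) atTop (𝓝 0) := by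
  have h : Tendsto (fun t : ℝ => (n + 1) * (Real.log t / t)) atTop (𝓝 0) := by
    simpa using (Real.isLittleO_log_id_atTop.tendsto_div_nhds_zero).const_mul ((n : ℝ) + 1)
  refine tendsto_of_tendsto_of_tendsto_of_le_of_le' tendsto_const_nhds h ?_ ?_
  · filter_upwards [eventually_ge_atTop 1] with t ht
    have hl := Real.log_nonneg ht
    exact div_nonneg (Real.log_nonneg (one_le_mul_of_one_le_of_one_le ht
      (one_le_pow₀ (by linarith)))) (by linarith)
  · filter_upwards [eventually_ge_atTop 1] with t ht
    have hl := Real.log_nonneg ht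
    have h1 : 1 + Real.log t ≤ t := by linarith [Real.log_le_sub_one_of_pos (by linarith : 0 < t)]
    have h2 := Real.log_le_log (by linarith) h1
    rw [Real.log_mul (by positivity) (by positivity), Real.log_pow, ← mul_div_assoc]
    gcongr
    nlinarith [mul_le_mul_of_nonneg_left h2 (Nat.cast_nonneg (α := ℝ) n)]

lemma tendsto_vfun_div (K : ℕ) (C : ℝ) :
    Tendsto (fun t => vfun K C t / t) atTop (𝓝 0) := by
  have h := tendsto_log_mul_one_add_log_pow_div (K + 2)
  have hC : Tendsto (fun t : ℝ => C / t) atTop (𝓝 0) := tendsto_const_nhds.div_atTop tendsto_id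
  simpa [vfun, add_div] using (hC.add h).add (tendsto_sqrt_const_mul_div h (4 * K))

lemma tendsto_abs_log_nhdsGT_zero : Tendsto (fun α => |Real.log α|) (𝓝[>] 0) atTop :=
  tendsto_abs_atBot_atTop.comp Real.tendsto_log_nhdsGT_zero

lemma tendsto_wfun_div (K : ℕ) :
    Tendsto (fun α => wfun K α / |Real.log α|) (𝓝[>] 0) (𝓝 1) := by
  have h : Tendsto (fun L : ℝ => L / L) atTop (𝓝 1) :=
    tendsto_const_nhds.congr' <| by
      filter_upwards [eventually_ne_atTop 0] with L hL using (div_self hL).symm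
  have h0 : Tendsto (fun L : ℝ => id L / L + Real.sqrt (4 * K * L) / L) atTop (𝓝 1) := by
    have hs : Tendsto (fun L : ℝ => Real.sqrt (4 * K * L) / L) atTop (𝓝 0) := by
      have hd := tendsto_sqrt_div_self.const_mul (Real.sqrt (4 * K))
      simpa [Real.sqrt_mul, mul_div_assoc] using hd
    simpa using h.add hs
  simpa [wfun, add_div, Function.comp_def] using h0.comp tendsto_abs_log_nhdsGT_zero

lemma N0_set_nonempty (K : ℕ) (C : ℝ) {Cstar : ℝ} (α : ℝ) :
    {N : ℕ | 2 ≤ N ∧ Real.sqrt N + (vfun K C N + wfun K α) / Cstar ≤ N}.Nonempty := by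
  have h : Tendsto (fun t : ℝ => Real.sqrt t / t + (vfun K C t / t + wfun K α / t) / Cstar)
      atTop (𝓝 0) := by
    simpa using tendsto_sqrt_div_self.add (((tendsto_vfun_div K C).add
      ((tendsto_const_nhds (x := wfun K α)).div_atTop tendsto_id)).div_const Cstar)
  have h' := (h.comp tendsto_natCast_atTop_atTop).eventually_lt_const one_pos
  obtain ⟨N, hN, hN2⟩ := (h'.and (eventually_ge_atTop 2)).exists
  have hpos : (0 : ℝ) < N := by exact_mod_cast (by omega : 0 < N)
  refine ⟨N, hN2, ?_⟩
  rw [Function.comp_apply, ← add_div, div_right_comm, ← add_div, div_lt_one hpos] at hN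
  exact hN.le

lemma eventually_N0_le_ceil (K : ℕ) (C : ℝ) {Cstar c : ℝ} (hCstar : 0 < Cstar)
    (hc : 1 / Cstar < c) :
    ∀ᶠ α in 𝓝[>] (0 : ℝ), N0 K C Cstar α ≤ ⌈c * |Real.log α|⌉₊ := by
  have hc0 : 0 < c := (one_div_pos.mpr hCstar).trans hc
  have hL := tendsto_abs_log_nhdsGT_zero
  have hNat : Tendsto (fun α => ⌈c * |Real.log α|⌉₊) (𝓝[>] (0 : ℝ)) atTop :=
    tendsto_nat_ceil_atTop.comp (hL.const_mul_atTop hc0)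
  have hN : Tendsto (fun α => (⌈c * |Real.log α|⌉₊ : ℝ)) (𝓝[>] (0 : ℝ)) atTop :=
    tendsto_natCast_atTop_atTop.comp hNat
  have hr : Tendsto (fun α => (⌈c * |Real.log α|⌉₊ : ℝ) / |Real.log α|) (𝓝[>] (0 : ℝ)) (𝓝 c) :=
    (tendsto_nat_ceil_mul_div_atTop hc0.le).comp hL
  have hs := (tendsto_sqrt_div_self.comp hN).mul hr
  have hv := ((tendsto_vfun_div K C).comp hN).mul hr
  have hlim := hs.add ((hv.add (tendsto_wfun_div K)).div_const Cstar)
  rw [zero_mul, zero_add, zero_add] at hlim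
  filter_upwards [hlim.eventually_lt hr hc, hNat.eventually_ge_atTop 2,
    hL.eventually_gt_atTop 0] with α h h2 hpos
  refine Nat.sInf_le ⟨h2, ?_⟩
  have hN0 : (⌈c * |Real.log α|⌉₊ : ℝ) ≠ 0 := by exact_mod_cast (by omega)
  simp only [Function.comp_apply] at h
  rw [div_mul_div_cancel₀ hN0, div_mul_div_cancel₀ hN0, ← add_div, div_right_comm, ← add_div,
    div_lt_div_iff_of_pos_right hpos] at h
  exact h.le

lemma limsup_N0_div_le (K : ℕ) (C : ℝ) {Cstar c : ℝ} (hCstar : 0 < Cstar)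
    (hc : 1 / Cstar < c) :
    limsup (fun α : ℝ => ((N0 K C Cstar α : ℝ) / |Real.log α| : EReal)) (𝓝[>] 0)
      ≤ (c : EReal) := by
  have hc0 : 0 < c := (one_div_pos.mpr hCstar).trans hc
  have hr := (tendsto_nat_ceil_mul_div_atTop hc0.le).comp tendsto_abs_log_nhdsGT_zero
  rw [← ((continuous_coe_real_ereal.tendsto c).comp hr).limsup_eq]
  refine limsup_le_limsup ?_
  filter_upwards [eventually_N0_le_ceil K C hCstar hc] with α h
  simp only [Function.comp_apply, ← EReal.coe_div, EReal.coe_le_coe_iff]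
  gcongr

/-- For `C* > 0`, the quantity
`N₀(α) = inf {N ≥ 2 : √N + (v(N) + w(α))/C* ≤ N}` is finite for every `α ∈ (0,1)`
(the defining set is nonempty), and `limsup_{α → 0⁺} N₀(α)/|log α| ≤ 1/C*`. -/
theorem N0_asymptotics
    (K : ℕ) (hK : 1 ≤ K) (C : ℝ) (Cstar : ℝ) (hCstar : 0 < Cstar) :
    (∀ α ∈ Set.Ioo (0 : ℝ) 1,
      {N : ℕ | 2 ≤ N ∧ Real.sqrt N + (vfun K C N + wfun K α) / Cstar ≤ N}.Nonempty) ∧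
    Filter.limsup (fun α : ℝ => ((N0 K C Cstar α : ℝ) / |Real.log α| : EReal))
      (nhdsWithin 0 (Set.Ioi 0)) ≤ ((1 / Cstar : ℝ) : EReal) := by
  refine ⟨fun α _ => N0_set_nonempty K C α, ?_⟩
  refine EReal.le_of_forall_lt_iff_le.mp fun c hc => ?_
  exact limsup_N0_div_le K C hCstar (EReal.coe_lt_coe_iff.mp hc)
end
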